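/- Let p, q, p₁, q₁ be integers with p < 0 < q, p₁ < 0 < q₁, -p₁ < q₁, and p₁q₁ = pq. Let g and b be natural numbers with b ≥ 1. If q₁·((2 - 2g - b)/b) + (q₁ - 1)·p₁ = pq - p + q (as rational numbers), then g = 0. -/

import Mathlib

/-- In the proof of the Claim inside Theorem 1: with `χ(S_J) = 2 - 2g - b`
for an orientable surface of genus `g` with `b ≥ 1` boundary components,
the relation `q₁ (χ(S_J)/b) + (q₁ - 1) p₁ = p q - p + q` forces `g = 0`. -/
theorem stmt_3 (p q p₁ q₁ : ℤ)
    (hp : p < 0) (hq : 0 < q)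
    (hp₁ : p₁ < 0) (hq₁ : 0 < q₁) (hpq₁ : -p₁ < q₁)
    (h1 : p₁ * q₁ = p * q)
    (g b : ℕ) (hb : 1 ≤ b)
    (hx : (q₁ : ℚ) * ((2 - 2 * (g : ℚ) - (b : ℚ)) / (b : ℚ))
        + ((q₁ : ℚ) - 1) * (p₁ : ℚ) = (p : ℚ) * q - p + q) :
    g = 0 := by
  by_contra hg
  have hg' : (1 : ℚ) ≤ g := by exact_mod_cast Nat.one_le_iff_ne_zero.mpr hg
  have hb' : (0 : ℚ) < b := by exact_mod_cast hb
  have hχ : (2 - 2 * (g : ℚ) - (b : ℚ)) / (b : ℚ) ≤ -1 := by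
    rw [div_le_iff₀ hb']
    linarith
  have hp' : (p : ℚ) < 0 := by exact_mod_cast hp
  have hq' : (0 : ℚ) < q := by exact_mod_cast hq
  have hq₁' : (0 : ℚ) < q₁ := by exact_mod_cast hq₁
  have hpq₁' : -(p₁ : ℚ) < q₁ := by exact_mod_cast hpq₁
  have h1' : (p₁ : ℚ) * q₁ = p * q := by exact_mod_cast h1
  have hmul := mul_le_mul_of_nonneg_left hχ hq₁'.le
  linarith
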